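/- arXiv:0901.2616 — 4 statements merged into one kernel-verified Lean document; each statement's English description precedes it below -/
import Mathlib

section
/- Let (Ω, μ) be a probability space and let X, Y : Ω → ℝ be measurable functions with X > 0 and Y > 0 almost everywhere. Then for every measurable power allocation P : Ω → [0, ∞), the lower Lebesgue integral ∫⁻ ENNReal.ofReal(log(1 + P(ω)·X(ω)) − log(1 + P(ω)·Y(ω))) dμ is at most ∫⁻ ENNReal.ofReal(log(X(ω)/Y(ω))) dμ. -/
open MeasureTheory

/-- Pointwise, the positive part of the secrecy rate is at most that of its high-power limit. -/
theorem ofReal_log_one_add_mul_sub_le {x y p : ℝ} (hx : 0 < x) (hy : 0 < y) (hp : 0 ≤ p) :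
    ENNReal.ofReal (Real.log (1 + p * x) - Real.log (1 + p * y)) ≤
      ENNReal.ofReal (Real.log (x / y)) := by
  have hpx : 0 < 1 + p * x := by positivity
  have hpy : 0 < 1 + p * y := by positivity
  rcases le_total x y with hxy | hyx
  · have hle : Real.log (1 + p * x) ≤ Real.log (1 + p * y) := by gcongr
    rw [ENNReal.ofReal_of_nonpos (sub_nonpos.mpr hle)]
    exact zero_le
  · apply ENNReal.ofReal_le_ofReal
    rw [← Real.log_div hpx.ne' hpy.ne']
    apply Real.log_le_log (div_pos hpx hpy)
    rw [div_le_div_iff₀ hpy hy]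
    linarith

/-- For any measurable power allocation `P : Ω → [0, ∞)` and a.e. positive channel gains
`X, Y`, the ergodic secrecy rate `∫⁻ (log(1 + P·X) − log(1 + P·Y))⁺ dμ` is at most the
high-SNR ergodic secrecy capacity `∫⁻ (log(X/Y))⁺ dμ`. -/
theorem ergodic_secrecy_rate_le_high_snr_capacity
    {Ω : Type*} [MeasurableSpace Ω] (μ : Measure Ω) [IsProbabilityMeasure μ]
    (X Y : Ω → ℝ) (hX : Measurable X) (hY : Measurable Y)
    (hXpos : ∀ᵐ ω ∂μ, 0 < X ω) (hYpos : ∀ᵐ ω ∂μ, 0 < Y ω)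
    (P : Ω → ℝ) (hP : Measurable P) (hPnn : ∀ ω, 0 ≤ P ω) :
    ∫⁻ ω, ENNReal.ofReal
        (Real.log (1 + P ω * X ω) - Real.log (1 + P ω * Y ω)) ∂μ ≤
      ∫⁻ ω, ENNReal.ofReal (Real.log (X ω / Y ω)) ∂μ := by
  apply lintegral_mono_ae
  filter_upwards [hXpos, hYpos] with ω hx hy
  exact ofReal_log_one_add_mul_sub_le hx hy (hPnn ω)
end

section
/- Let (Ω, μ) be a probability space and let X, Y : Ω → ℝ be measurable with X > 0 and Y > 0 almost everywhere. Define for c > 0 the channel-inversion power allocation P_c(ω) = c / min(X(ω), Y(ω)). Then, as c → ∞, the lower Lebesgue integral ∫⁻ ENNReal.ofReal(log(1 + P_c(ω)·X(ω)) − log(1 + P_c(ω)·Y(ω))) dμ tends to ∫⁻ ENNReal.ofReal(log(X(ω)/Y(ω))) dμ. -/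
open MeasureTheory Filter

/-- For gains `x, y > 0`, the secrecy rate `log (1 + p x) - log (1 + p y)` at power `p` tends to
`log (x / y)` as `p → ∞`. -/
lemma tendsto_log_one_add_mul_sub_log_one_add_mul {x y : ℝ} (hx : 0 < x) (hy : 0 < y) :
    Tendsto (fun p : ℝ => Real.log (1 + p * x) - Real.log (1 + p * y)) atTop
      (nhds (Real.log (x / y))) := by
  have hlim : Tendsto (fun p : ℝ => Real.log (p⁻¹ + x) - Real.log (p⁻¹ + y)) atTop
      (nhds (Real.log (0 + x) - Real.log (0 + y))) :=
    ((tendsto_inv_atTop_zero.add_const x).log (by simpa using hx.ne')).sub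
      ((tendsto_inv_atTop_zero.add_const y).log (by simpa using hy.ne'))
  rw [zero_add, zero_add, ← Real.log_div hx.ne' hy.ne'] at hlim
  refine hlim.congr' ?_
  filter_upwards [eventually_gt_atTop 0] with p hp
  have key : ∀ z : ℝ, 0 < z → Real.log (1 + p * z) = Real.log p + Real.log (p⁻¹ + z) := by
    intro z hz
    rw [← Real.log_mul hp.ne' (by positivity), mul_add, mul_inv_cancel₀ hp.ne']
  rw [key x hx, key y hy]
  ring

/-- The positive part of the secrecy rate at any power `p ≥ 0` is at most that of its high-power
limit `log (x / y)`. -/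
lemma ofReal_log_one_add_mul_sub_log_one_add_mul_le {p x y : ℝ} (hp : 0 ≤ p) (hx : 0 < x)
    (hy : 0 < y) :
    ENNReal.ofReal (Real.log (1 + p * x) - Real.log (1 + p * y)) ≤
      ENNReal.ofReal (Real.log (x / y)) := by
  rcases le_total x y with hxy | hxy
  · rw [ENNReal.ofReal_of_nonpos]
    · exact zero_le
    · exact sub_nonpos.2 (Real.log_le_log (by positivity) (by gcongr))
  · refine ENNReal.ofReal_le_ofReal ?_
    rw [← Real.log_div (by positivity) (by positivity)]
    refine Real.log_le_log (by positivity) ?_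
    rw [div_le_div_iff₀ (by positivity) hy]
    linarith

/-- With the channel-inversion power allocation `P_c(ω) = c / min(X ω, Y ω)`, the
ergodic secrecy rate `∫⁻ (log(1 + P_c·X) − log(1 + P_c·Y))⁺ dμ` tends, as `c → ∞`,
to the high-SNR ergodic secrecy capacity `∫⁻ (log(X/Y))⁺ dμ`. -/
theorem ergodic_secrecy_rate_channel_inversion_tendsto_high_snr_capacity
    {Ω : Type*} [MeasurableSpace Ω] (μ : Measure Ω) [IsProbabilityMeasure μ]
    (X Y : Ω → ℝ) (hX : Measurable X) (hY : Measurable Y)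
    (hXpos : ∀ᵐ ω ∂μ, 0 < X ω) (hYpos : ∀ᵐ ω ∂μ, 0 < Y ω) :
    Tendsto (fun c : ℝ =>
        ∫⁻ ω, ENNReal.ofReal
          (Real.log (1 + (c / min (X ω) (Y ω)) * X ω) -
            Real.log (1 + (c / min (X ω) (Y ω)) * Y ω)) ∂μ)
      atTop
      (nhds (∫⁻ ω, ENNReal.ofReal (Real.log (X ω / Y ω)) ∂μ)) := by
  have hconv : ∀ᵐ ω ∂μ, Tendsto (fun c : ℝ => ENNReal.ofReal
      (Real.log (1 + (c / min (X ω) (Y ω)) * X ω) -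
        Real.log (1 + (c / min (X ω) (Y ω)) * Y ω)))
      atTop (nhds (ENNReal.ofReal (Real.log (X ω / Y ω)))) := by
    filter_upwards [hXpos, hYpos] with ω hx hy
    exact ENNReal.tendsto_ofReal ((tendsto_log_one_add_mul_sub_log_one_add_mul hx hy).comp
      (tendsto_id.atTop_div_const (lt_min hx hy)))
  have hbound : ∀ᶠ c : ℝ in atTop, ∫⁻ ω, ENNReal.ofReal
      (Real.log (1 + (c / min (X ω) (Y ω)) * X ω) -
        Real.log (1 + (c / min (X ω) (Y ω)) * Y ω)) ∂μ ≤
      ∫⁻ ω, ENNReal.ofReal (Real.log (X ω / Y ω)) ∂μ := by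
    filter_upwards [eventually_ge_atTop 0] with c hc
    refine lintegral_mono_ae ?_
    filter_upwards [hXpos, hYpos] with ω hx hy
    exact ofReal_log_one_add_mul_sub_log_one_add_mul_le
      (div_nonneg hc (lt_min hx hy).le) hx hy
  refine tendsto_of_le_liminf_of_limsup_le ?_ (limsup_le_of_le (h := hbound))
  -- Fatou's lemma gives the lower bound even when the limiting integral is infinite.
  calc ∫⁻ ω, ENNReal.ofReal (Real.log (X ω / Y ω)) ∂μ
      = ∫⁻ ω, liminf (fun c : ℝ => ENNReal.ofReal
          (Real.log (1 + (c / min (X ω) (Y ω)) * X ω) -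
            Real.log (1 + (c / min (X ω) (Y ω)) * Y ω))) atTop ∂μ :=
        lintegral_congr_ae (hconv.mono fun ω h => h.liminf_eq.symm)
    _ ≤ _ := lintegral_liminf_le fun c => by fun_prop
end

section
/- Let (Ω, μ) be a probability space and let X, Y : Ω → ℝ be measurable with X > 0 and Y > 0 almost everywhere. Assume ∫ 1/min(X, Y) dμ is finite and ω ↦ max(log(X(ω)/Y(ω)), 0) is integrable. For P̄ > 0 define S(P̄) as the supremum, over all measurable P : Ω → [0, ∞) with ∫ P dμ ≤ P̄, of min( ∫ max(log(1 + P·X) − log(1 + P·Y), 0) dμ , essInf_μ (ω ↦ log(1 + P(ω)·X(ω))) ). Then S(P̄) tends to ∫ max(log(X/Y), 0) dμ as P̄ → ∞. -/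
open MeasureTheory Filter

/-- The secrecy rate at any finite power is at most its high-power limit. -/
lemma max_log_one_add_mul_sub_le {p x y : ℝ} (hp : 0 ≤ p) (hx : 0 < x) (hy : 0 < y) :
    max (Real.log (1 + p * x) - Real.log (1 + p * y)) 0 ≤ max (Real.log (x / y)) 0 := by
  have hpx : 0 < 1 + p * x := by positivity
  have hpy : 0 < 1 + p * y := by positivity
  rcases le_total x y with h | h
  · have : Real.log (1 + p * x) ≤ Real.log (1 + p * y) := Real.log_le_log hpx (by gcongr)
    exact max_le (le_max_of_le_right (by linarith)) (le_max_right _ _)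
  · refine max_le_max_right _ ?_
    rw [← Real.log_div hpx.ne' hpy.ne']
    refine Real.log_le_log (by positivity) ?_
    rw [div_le_div_iff₀ hpy hy]
    linarith [mul_comm (p * x) y, mul_comm (p * y) x, mul_left_comm p x y]

lemma tendsto_log_one_add_mul_sub {x y : ℝ} (hx : 0 < x) (hy : 0 < y) :
    Tendsto (fun t : ℝ => Real.log (1 + t * x) - Real.log (1 + t * y)) atTop
      (nhds (Real.log (x / y))) := by
  have hlim : ∀ z : ℝ, 0 < z →
      Tendsto (fun t : ℝ => Real.log (t⁻¹ + z)) atTop (nhds (Real.log z)) := fun z hz => by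
    have h : Tendsto (fun t : ℝ => t⁻¹ + z) atTop (nhds z) := by
      simpa using (tendsto_inv_atTop_zero (𝕜 := ℝ)).add_const z
    exact h.log hz.ne'
  rw [Real.log_div hx.ne' hy.ne']
  refine ((hlim x hx).sub (hlim y hy)).congr' ?_
  filter_upwards [eventually_gt_atTop (0 : ℝ)] with t ht
  have hfactor : ∀ z : ℝ, 0 < z → Real.log (1 + t * z) = Real.log t + Real.log (t⁻¹ + z) :=
    fun z hz => by
      rw [← Real.log_mul ht.ne' (by positivity), mul_add, mul_inv_cancel₀ ht.ne']
  rw [hfactor x hx, hfactor y hy]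
  ring

/-- A lower bound valid almost everywhere is at most the essential infimum of a real function. -/
lemma le_essInf_of_ae_le_real {Ω : Type*} [MeasurableSpace Ω] {μ : Measure Ω} [NeZero μ]
    {f : Ω → ℝ} {c : ℝ} (h : ∀ᵐ ω ∂μ, c ≤ f ω) : c ≤ essInf f μ := by
  refine le_liminf_of_le ?_ h
  have hex : ∃ n : ℕ, ¬ ∀ᵐ ω ∂μ, (n : ℝ) < f ω := by
    by_contra! hall
    have hfalse : ∀ᵐ _ ∂μ, False := by
      filter_upwards [ae_all_iff.2 hall] with ω hω
      obtain ⟨n, hn⟩ := exists_nat_gt (f ω)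
      exact lt_asymm hn (hω n)
    obtain ⟨_, hω⟩ := hfalse.exists
    exact hω
  obtain ⟨n, hn⟩ := hex
  refine IsCoboundedUnder.of_frequently_le (a := (n : ℝ)) ?_
  exact (not_eventually.1 hn).mono fun ω hω => not_lt.1 hω

/-- High-SNR delay-limited secrecy capacity (full CSI): the supremum, over power policies
`P ≥ 0` with `∫ P dμ ≤ P̄`, of the minimum of the ergodic secrecy rate
`∫ (log(1 + P·X) − log(1 + P·Y))⁺ dμ` and the delay-limited rate
`essInf log(1 + P·X)`, tends to `∫ (log(X/Y))⁺ dμ` as `P̄ → ∞`. -/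
theorem delay_limited_secrecy_capacity_high_snr_full_csi
    {Ω : Type*} [MeasurableSpace Ω] (μ : Measure Ω) [IsProbabilityMeasure μ]
    (X Y : Ω → ℝ) (hX : Measurable X) (hY : Measurable Y)
    (hXpos : ∀ᵐ ω ∂μ, 0 < X ω) (hYpos : ∀ᵐ ω ∂μ, 0 < Y ω)
    (hinv : Integrable (fun ω => 1 / min (X ω) (Y ω)) μ)
    (hlog : Integrable (fun ω => max (Real.log (X ω / Y ω)) 0) μ) :
    Tendsto (fun Pbar : ℝ =>
        sSup {r : ℝ | ∃ P : Ω → ℝ, Measurable P ∧ (∀ ω, 0 ≤ P ω) ∧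
          Integrable P μ ∧ (∫ ω, P ω ∂μ) ≤ Pbar ∧
          r = min
            (∫ ω, max (Real.log (1 + P ω * X ω) - Real.log (1 + P ω * Y ω)) 0 ∂μ)
            (essInf (fun ω => Real.log (1 + P ω * X ω)) μ)})
      atTop
      (nhds (∫ ω, max (Real.log (X ω / Y ω)) 0 ∂μ)) := by
  set L := ∫ ω, max (Real.log (X ω / Y ω)) 0 ∂μ
  set Q : Ω → ℝ := fun ω => |1 / min (X ω) (Y ω)| with hQ
  have hQmeas : Measurable Q := (measurable_const.div (hX.min hY)).norm
  have hQint : Integrable Q μ := hinv.abs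
  set m := ∫ ω, Q ω ∂μ with hm
  have hm0 : 0 ≤ m := integral_nonneg fun ω => abs_nonneg _
  have hcoef : Tendsto (fun p : ℝ => p / (m + 1)) atTop atTop :=
    tendsto_id.atTop_div_const (by positivity)
  have hupper : ∀ P : Ω → ℝ, (∀ ω, 0 ≤ P ω) →
      (∫ ω, max (Real.log (1 + P ω * X ω) - Real.log (1 + P ω * Y ω)) 0 ∂μ) ≤ L := by
    intro P hP
    refine integral_mono_of_nonneg (ae_of_all _ fun ω => le_max_right _ _) hlog ?_
    filter_upwards [hXpos, hYpos] with ω hx hy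
    exact max_log_one_add_mul_sub_le (hP ω) hx hy
  have hergodic : Tendsto (fun c : ℝ => ∫ ω, max (Real.log (1 + c * Q ω * X ω) -
      Real.log (1 + c * Q ω * Y ω)) 0 ∂μ) atTop (nhds L) := by
    refine tendsto_integral_filter_of_dominated_convergence _ ?_ ?_ hlog ?_
    · refine Eventually.of_forall fun c => Measurable.aestronglyMeasurable ?_
      fun_prop
    · filter_upwards [eventually_ge_atTop (0 : ℝ)] with c hc
      filter_upwards [hXpos, hYpos] with ω hx hy
      rw [Real.norm_of_nonneg (le_max_right _ _)]
      exact max_log_one_add_mul_sub_le (mul_nonneg hc (abs_nonneg _)) hx hy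
    · filter_upwards [hXpos, hYpos] with ω hx hy
      have hQpos : 0 < Q ω := abs_pos.2 (one_div_pos.2 (lt_min hx hy)).ne'
      exact ((tendsto_log_one_add_mul_sub hx hy).comp
        (tendsto_id.atTop_mul_const hQpos)).max tendsto_const_nhds
  have hdelay : Tendsto (fun c : ℝ => Real.log (1 + c)) atTop atTop :=
    Real.tendsto_log_atTop.comp (tendsto_atTop_add_const_left _ _ tendsto_id)
  have hlower : Tendsto (fun c : ℝ => min (∫ ω, max (Real.log (1 + c * Q ω * X ω) -
      Real.log (1 + c * Q ω * Y ω)) 0 ∂μ) (Real.log (1 + c))) atTop (nhds L) := by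
    refine hergodic.congr' ?_
    filter_upwards [eventually_ge_atTop (0 : ℝ), hdelay.eventually_ge_atTop L] with c hc hcL
    exact (min_eq_left ((hupper _ fun ω => mul_nonneg hc (abs_nonneg _)).trans hcL)).symm
  refine tendsto_of_tendsto_of_tendsto_of_le_of_le' (hlower.comp hcoef) tendsto_const_nhds ?_ ?_
  · filter_upwards [eventually_ge_atTop (0 : ℝ)] with p hp
    have hc : 0 ≤ p / (m + 1) := by positivity
    refine le_csSup_of_le ⟨L, ?_⟩ ⟨fun ω => p / (m + 1) * Q ω, hQmeas.const_mul _,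
      fun ω => mul_nonneg hc (abs_nonneg _), hQint.const_mul _, ?_, rfl⟩ ?_
    · rintro r ⟨P, -, hP, -, -, rfl⟩
      exact (min_le_left _ _).trans (hupper P hP)
    · rw [integral_const_mul, ← hm, div_mul_eq_mul_div, div_le_iff₀ (by positivity)]
      nlinarith
    · refine min_le_min_left _ (le_essInf_of_ae_le_real ?_)
      filter_upwards [hXpos, hYpos] with ω hx hy
      have hmin : 0 < min (X ω) (Y ω) := lt_min hx hy
      have hQX : 1 ≤ Q ω * X ω := by
        simp only [hQ]
        rw [abs_of_pos (one_div_pos.2 hmin), one_div_mul_eq_div, one_le_div hmin]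
        exact min_le_left _ _
      refine Real.log_le_log (by positivity) ?_
      rw [mul_assoc]
      linarith [le_mul_of_one_le_right hc hQX]
  · filter_upwards [eventually_ge_atTop (0 : ℝ)] with p hp
    refine csSup_le ⟨_, fun _ => 0, measurable_const, fun _ => le_rfl, integrable_zero _ _ _,
      by simpa using hp, rfl⟩ ?_
    rintro r ⟨P, -, hP, -, -, rfl⟩
    exact (min_le_left _ _).trans (hupper P hP)
end

section
/- Let (Ω, μ) be a probability space and let X, Y : Ω → ℝ be measurable with X > 0 and Y > 0 almost everywhere. Assume ∫ 1/X dμ < ∞ and μ({ω : Y(ω) < X(ω)}) > 0. Then for every P̄ > 0 there exist c > 0 and R > 0 such that ∫ c/X dμ ≤ P̄, R ≤ log(1 + c), and R ≤ ∫ max(log(1 + c) − R − log(1 + c·Y(ω)/X(ω)), 0) dμ. -/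
open MeasureTheory

/-- If `Z` is bounded above and positive with positive probability, then half the mean of `Z⁺`
is a positive rate `R` bounded by `E[(Z - R)⁺]`. -/
lemma exists_pos_le_integral_max_sub {Ω : Type*} [MeasurableSpace Ω] (μ : Measure Ω)
    [IsProbabilityMeasure μ] {Z : Ω → ℝ} {L : ℝ} (hZ : Measurable Z) (hL : 0 ≤ L)
    (hZL : ∀ᵐ ω ∂μ, Z ω ≤ L) (hpos : 0 < μ {ω | 0 < Z ω}) :
    ∃ R : ℝ, 0 < R ∧ R ≤ L ∧ R ≤ ∫ ω, max (Z ω - R) 0 ∂μ := by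
  have integrable_max (r : ℝ) (hr : 0 ≤ r) : Integrable (fun ω => max (Z ω - r) 0) μ := by
    refine Integrable.of_bound ((hZ.sub_const r).max measurable_const).aestronglyMeasurable L ?_
    filter_upwards [hZL] with ω hω
    rw [Real.norm_of_nonneg (le_max_right _ _)]
    exact max_le (by linarith) hL
  have hint : Integrable (fun ω => max (Z ω) 0) μ := by simpa using integrable_max 0 le_rfl
  set J := ∫ ω, max (Z ω) 0 ∂μ with hJ
  have hJpos : 0 < J := by
    refine (integral_pos_iff_support_of_nonneg (fun ω => le_max_right (Z ω) 0) hint).2 ?_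
    refine hpos.trans_le (measure_mono fun ω hω => ?_)
    exact (lt_max_of_lt_left hω).ne'
  have hJL : J ≤ L := by
    calc J ≤ ∫ _, L ∂μ := by
          refine integral_mono_ae hint (integrable_const L) ?_
          filter_upwards [hZL] with ω hω using max_le hω hL
      _ = L := by simp
  refine ⟨J / 2, by linarith, by linarith, ?_⟩
  calc J / 2 = ∫ ω, (max (Z ω) 0 - J / 2) ∂μ := by
        rw [integral_sub hint (integrable_const _), ← hJ]
        simp
        ring
    _ ≤ ∫ ω, max (Z ω - J / 2) 0 ∂μ := by
        refine integral_mono (hint.sub (integrable_const _))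
          (integrable_max _ (by linarith)) fun ω => ?_
        rw [← max_sub_sub_right]
        exact max_le_max le_rfl (by linarith)

/-- Positive delay-limited secrecy rate with main-CSI only, for invertible channels:
if `∫ 1/X dμ < ∞` and `μ{Y < X} > 0`, then for every average power budget `P̄ > 0`
there exist a power scaling `c > 0` and a rate `R > 0` such that the channel-inversion
policy `c/X` meets the power constraint, `R ≤ log(1 + c)`, and the key renewal rate
`∫ (log(1 + c) − R − log(1 + c·Y/X))⁺ dμ` is at least `R`. -/
theorem positive_delay_limited_secrecy_rate_main_csi
    {Ω : Type*} [MeasurableSpace Ω] (μ : Measure Ω) [IsProbabilityMeasure μ]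
    (X Y : Ω → ℝ) (hX : Measurable X) (hY : Measurable Y)
    (hXpos : ∀ᵐ ω ∂μ, 0 < X ω) (hYpos : ∀ᵐ ω ∂μ, 0 < Y ω)
    (hinv : Integrable (fun ω => 1 / X ω) μ)
    (hset : 0 < μ {ω | Y ω < X ω})
    (Pbar : ℝ) (hPbar : 0 < Pbar) :
    ∃ c R : ℝ, 0 < c ∧ 0 < R ∧
      (∫ ω, c / X ω ∂μ) ≤ Pbar ∧
      R ≤ Real.log (1 + c) ∧
      R ≤ ∫ ω, max (Real.log (1 + c) - R - Real.log (1 + c * Y ω / X ω)) 0 ∂μ := by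
  have hI : 0 ≤ ∫ ω, 1 / X ω ∂μ := by
    refine integral_nonneg_of_ae ?_
    filter_upwards [hXpos] with ω hω
    exact (one_div_pos.2 hω).le
  set I := ∫ ω, 1 / X ω ∂μ with hI_def
  obtain ⟨c, hc, hcI⟩ : ∃ c : ℝ, 0 < c ∧ c * I ≤ Pbar := by
    refine ⟨Pbar / (I + 1), by positivity, ?_⟩
    rw [div_mul_eq_mul_div, div_le_iff₀ (by linarith)]
    nlinarith
  have hpower : ∫ ω, c / X ω ∂μ ≤ Pbar := by
    rw [hI_def, ← integral_const_mul] at hcI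
    simpa [div_eq_mul_inv] using hcI
  have hbound : ∀ᵐ ω ∂μ,
      Real.log (1 + c) - Real.log (1 + c * Y ω / X ω) ≤ Real.log (1 + c) := by
    filter_upwards [hXpos, hYpos] with ω hx hy
    have : 0 ≤ c * Y ω / X ω := by positivity
    linarith [Real.log_nonneg (show (1 : ℝ) ≤ 1 + c * Y ω / X ω by linarith)]
  have hpos : 0 < μ {ω | 0 < Real.log (1 + c) - Real.log (1 + c * Y ω / X ω)} := by
    refine hset.trans_le (measure_mono_ae ?_)
    filter_upwards [hXpos, hYpos] with ω hx hy (hlt : Y ω < X ω)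
    have hlt' : c * Y ω / X ω < c := by
      rw [div_lt_iff₀ hx]
      exact mul_lt_mul_of_pos_left hlt hc
    have : 0 < c * Y ω / X ω := by positivity
    exact sub_pos.2 (Real.log_lt_log (by linarith) (by linarith))
  obtain ⟨R, hR, hRL, hRint⟩ := exists_pos_le_integral_max_sub μ
    (by fun_prop) (Real.log_nonneg (by linarith)) hbound hpos
  refine ⟨c, R, hc, hR, hpower, hRL, ?_⟩
  simpa only [sub_right_comm] using hRint
end
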